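/- For every positive integer N, every d ≥ 3, and every k in Z/NZ, the number of d-tuples (x_1,...,x_d) in (Z/NZ)^d with x_1^2 + ... + x_d^2 ≡ k (mod N) is divisible by N. -/

import Mathlib

open Finset in
theorem aux_sum_range (N : ℕ) [NeZero N] (f : ZMod N → ℕ) :
    ∑ x, f x = ∑ i ∈ range N, f (i : ZMod N) := by
  refine Finset.sum_bij' (fun x _ => x.val) (fun i _ => (i : ZMod N)) ?_ ?_ ?_ ?_ ?_
  · intro a _; simpa using ZMod.val_lt a
  · intro a _; simp
  · intro a _; simp
  · intro a ha; exact ZMod.val_cast_of_lt (by simpa using ha)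
  · intro a _; simp

open Finset in
theorem aux_per (P : ℕ) (g : ℕ → ℕ) (hg : ∀ i, g (i + P) = g i) (l : ℕ) :
    ∑ i ∈ range (P * l), g i = l * ∑ i ∈ range P, g i := by
  have hg' : ∀ l i, g (P * l + i) = g i := by
    intro l
    induction l with
    | zero => intro i; simp
    | succ l ih =>
      intro i
      rw [← ih i, ← hg (P * l + i)]; congr 1; ring
  induction l with
  | zero => simp
  | succ l ih =>
    rw [Nat.mul_succ, Finset.sum_range_add, ih]
    simp only [hg']
    ring

open Finset in
theorem aux_mult (p : ℕ) (hp : 0 < p) (h : ℕ → ℕ) (m : ℕ) :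
    ∑ i ∈ range (p * m), (if p ∣ i then h i else 0) = ∑ i ∈ range m, h (p * i) := by
  rw [← Finset.sum_filter]
  symm
  refine Finset.sum_bij (fun i _ => p * i) ?_ ?_ ?_ ?_
  · intro a ha
    simp only [mem_filter, mem_range] at *
    exact ⟨Nat.mul_lt_mul_of_pos_left ha hp, dvd_mul_right _ _⟩
  · intro a _ b _ hab
    exact Nat.eq_of_mul_eq_mul_left hp hab
  · intro b hb
    simp only [mem_filter, mem_range] at hb
    obtain ⟨hb, c, rfl⟩ := hb
    exact ⟨c, by simpa using Nat.lt_of_mul_lt_mul_left hb, rfl⟩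
  · intro a _; rfl

theorem aux_per2 (N P l : ℕ) [NeZero N] (hN : P * l = N) (f : ZMod N → ZMod N → ℕ)
    (h1 : ∀ y z, f (y + P) z = f y z) (h2 : ∀ y z, f y (z + P) = f y z) :
    l * l ∣ ∑ y, ∑ z, f y z := by
  have key : ∀ g : ZMod N → ℕ, (∀ y, g (y + P) = g y) →
      ∑ y, g y = l * ∑ i ∈ Finset.range P, g (i : ZMod N) := by
    intro g hg
    rw [aux_sum_range]
    have h := aux_per P (fun i => g (i : ZMod N)) (fun i => by simp [hg]) l
    rwa [hN] at h
  rw [key _ (fun y => by simp [h1])]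
  simp_rw [key _ (h2 _)]
  rw [← Finset.mul_sum, ← mul_assoc]
  exact dvd_mul_right _ _

/-- number of unit square roots -/
def auxRho (N : ℕ) [NeZero N] (c : ZMod N) : ℕ :=
  ∑ x : ZMod N, if IsUnit x ∧ x ^ 2 = c then 1 else 0

theorem auxRho_unit (N : ℕ) [NeZero N] (c w : ZMod N) (hw : IsUnit w) :
    auxRho N (c * w ^ 2) = auxRho N c := by
  obtain ⟨w, rfl⟩ := hw
  unfold auxRho
  symm
  refine Fintype.sum_equiv (Units.mulRight w) _ _ ?_
  intro x
  have : (x * w) ^ 2 = c * (w : ZMod N) ^ 2 ↔ x ^ 2 = c := by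
    rw [mul_pow]
    exact (w.isUnit.pow 2).mul_left_inj
  simp [this]

theorem auxRho_nonunit (N : ℕ) [NeZero N] (c : ZMod N) (hc : ¬ IsUnit c) :
    auxRho N c = 0 := by
  unfold auxRho
  apply Finset.sum_eq_zero
  intro x _
  rw [if_neg]
  rintro ⟨h, rfl⟩
  exact hc (h.pow 2)

theorem aux_sqrt (N : ℕ) [NeZero N] (q : ZMod N) (hq : IsNilpotent q) (s : ZMod N) :
    ∃ w : ZMod N, IsUnit w ∧ w ^ 2 = 1 + 4 * q * s := by
  have inj : Function.Injective (fun t : ZMod N => t + q * t ^ 2) := by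
    intro t u h
    have h' : (t - u) * (1 + q * (t + u)) = 0 := by
      simp only at h
      linear_combination h
    have hu : IsUnit (1 + q * (t + u)) :=
      IsNilpotent.isUnit_one_add (Commute.isNilpotent_mul_right (Commute.all _ _) hq)
    have := (hu.mul_left_eq_zero).1 h'
    exact sub_eq_zero.1 this
  obtain ⟨t, ht⟩ := (Finite.injective_iff_surjective.1 inj) s
  refine ⟨1 + q * (2 * t), ?_, ?_⟩
  · exact IsNilpotent.isUnit_one_add (Commute.isNilpotent_mul_right (Commute.all _ _) hq)
  · rw [← ht]; ring

theorem auxRho_add (N : ℕ) [NeZero N] (q : ZMod N) (hq : IsNilpotent q) (c s : ZMod N) :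
    auxRho N (c + 4 * q * s) = auxRho N c := by
  by_cases hc : IsUnit c
  · obtain ⟨c, rfl⟩ := hc
    obtain ⟨w, hw, hw2⟩ := aux_sqrt N q hq (s * (c⁻¹ : (ZMod N)ˣ))
    rw [← auxRho_unit N c w hw, hw2]
    congr 1
    have : (c : ZMod N) * (c⁻¹ : (ZMod N)ˣ) = 1 := by simp
    linear_combination (-4 * q * s) * this
  · rw [auxRho_nonunit N c hc, auxRho_nonunit]
    intro h
    apply hc
    have hn : IsNilpotent (-(4 * q * s)) := by
      have : -(4 * q * s) = q * (-4 * s) := by ring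
      rw [this]
      exact Commute.isNilpotent_mul_right (Commute.all _ _) hq
    have := hn.isUnit_add_left_of_commute h (Commute.all _ _)
    simpa using this

/-- triple count -/
def auxT (N : ℕ) [NeZero N] (k : ZMod N) : ℕ :=
  ∑ x : ZMod N, ∑ y : ZMod N, ∑ z : ZMod N, if x ^ 2 + y ^ 2 + z ^ 2 = k then 1 else 0

theorem aux_prim (N P l q : ℕ) [NeZero N] (hN : P * l = N) (hl : N ∣ l * l)
    (hq : IsNilpotent (q : ZMod N))
    (hP : ∀ y : ZMod N, ∃ s : ZMod N, (y + P) ^ 2 - y ^ 2 = 4 * q * s)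
    (k : ZMod N) (u w : ZMod N → ℕ) (hu : ∀ y, u (y + P) = u y) (hw : ∀ y, w (y + P) = w y) :
    N ∣ ∑ y, ∑ z, u y * w z * auxRho N (k - y ^ 2 - z ^ 2) := by
  refine hl.trans (aux_per2 N P l hN _ ?_ ?_)
  · intro y z
    obtain ⟨s, hs⟩ := hP y
    rw [hu, ← auxRho_add N q hq (k - y ^ 2 - z ^ 2) (-s)]
    congr 2
    linear_combination -hs
  · intro y z
    obtain ⟨s, hs⟩ := hP z
    rw [hw, ← auxRho_add N q hq (k - y ^ 2 - z ^ 2) (-s)]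
    congr 2
    linear_combination -hs

open Classical in
theorem aux_split (N : ℕ) [NeZero N] (k : ZMod N) :
    auxT N k = (∑ y, ∑ z, 1 * 1 * auxRho N (k - y ^ 2 - z ^ 2))
      + (∑ y, ∑ z, (if IsUnit y then 0 else 1) * 1 * auxRho N (k - y ^ 2 - z ^ 2))
      + (∑ y, ∑ z, (if IsUnit y then 0 else 1) * (if IsUnit z then 0 else 1)
          * auxRho N (k - y ^ 2 - z ^ 2))
      + ∑ x : ZMod N, if IsUnit x then 0 else ∑ y : ZMod N, if IsUnit y then 0 else
          ∑ z : ZMod N, if IsUnit z then 0 else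
          if x ^ 2 + y ^ 2 + z ^ 2 = k then 1 else 0 := by
  have e1 : (∑ y, ∑ z, 1 * 1 * auxRho N (k - y ^ 2 - z ^ 2)) =
      ∑ x : ZMod N, ∑ y : ZMod N, ∑ z : ZMod N,
        if IsUnit x ∧ x ^ 2 + y ^ 2 + z ^ 2 = k then 1 else 0 := by
    unfold auxRho
    simp only [Finset.mul_sum]
    rw [Finset.sum_comm_cycle]
    refine Finset.sum_congr rfl fun x _ => Finset.sum_congr rfl fun y _ =>
      Finset.sum_congr rfl fun z _ => ?_
    have : x ^ 2 = k - y ^ 2 - z ^ 2 ↔ x ^ 2 + y ^ 2 + z ^ 2 = k := by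
      constructor <;> intro h <;> linear_combination h
    simp [this]
  have e2 : (∑ y, ∑ z, (if IsUnit y then 0 else 1) * 1 * auxRho N (k - y ^ 2 - z ^ 2)) =
      ∑ x : ZMod N, ∑ y : ZMod N, ∑ z : ZMod N,
        if ¬ IsUnit x ∧ IsUnit y ∧ x ^ 2 + y ^ 2 + z ^ 2 = k then 1 else 0 := by
    unfold auxRho
    simp only [Finset.mul_sum]
    refine Finset.sum_congr rfl fun x _ => ?_
    rw [Finset.sum_comm]
    refine Finset.sum_congr rfl fun y _ =>
      Finset.sum_congr rfl fun z _ => ?_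
    have : y ^ 2 = k - x ^ 2 - z ^ 2 ↔ x ^ 2 + y ^ 2 + z ^ 2 = k := by
      constructor <;> intro h <;> linear_combination h
    by_cases hx : IsUnit x <;> simp [this, hx]
  have e3 : (∑ y, ∑ z, (if IsUnit y then 0 else 1) * (if IsUnit z then 0 else 1)
          * auxRho N (k - y ^ 2 - z ^ 2)) =
      ∑ x : ZMod N, ∑ y : ZMod N, ∑ z : ZMod N,
        if ¬ IsUnit x ∧ ¬ IsUnit y ∧ IsUnit z ∧ x ^ 2 + y ^ 2 + z ^ 2 = k then 1 else 0 := by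
    unfold auxRho
    simp only [Finset.mul_sum]
    refine Finset.sum_congr rfl fun x _ => Finset.sum_congr rfl fun y _ =>
      Finset.sum_congr rfl fun z _ => ?_
    have : z ^ 2 = k - x ^ 2 - y ^ 2 ↔ x ^ 2 + y ^ 2 + z ^ 2 = k := by
      constructor <;> intro h <;> linear_combination h
    by_cases hx : IsUnit x <;> by_cases hy : IsUnit y <;> simp [this, hx, hy]
  rw [e1, e2, e3]
  unfold auxT
  simp only [← Finset.sum_add_distrib]
  refine Finset.sum_congr rfl fun x _ => ?_
  by_cases hx : IsUnit x
  · simp [hx]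
  simp only [hx, if_false, ← Finset.sum_add_distrib]
  refine Finset.sum_congr rfl fun y _ => ?_
  by_cases hy : IsUnit y
  · simp [hy]
  simp only [hy, if_false, ← Finset.sum_add_distrib]
  refine Finset.sum_congr rfl fun z _ => ?_
  by_cases hz : IsUnit z <;> simp [hz]

open Classical in
theorem aux_nonunit_sum (p n : ℕ) (hp : p.Prime) [NeZero (p ^ (n + 2))]
    (f : ZMod (p ^ (n + 2)) → ℕ) :
    (∑ x, if IsUnit x then 0 else f x) =
      ∑ i ∈ Finset.range (p ^ n * p), f ((p : ZMod (p ^ (n + 2))) * i) := by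
  rw [aux_sum_range]
  have : ∀ i : ℕ, IsUnit (i : ZMod (p ^ (n + 2))) ↔ ¬ p ∣ i := by
    intro i
    rw [ZMod.isUnit_iff_coprime, Nat.coprime_pow_right_iff (by omega), Nat.coprime_comm,
      hp.coprime_iff_not_dvd]
  simp only [this, ite_not]
  have h2 := aux_mult p hp.pos (fun i => f (i : ZMod (p ^ (n + 2)))) (p ^ n * p)
  rw [show p * (p ^ n * p) = p ^ (n + 2) by ring] at h2
  rw [h2]
  simp

open Classical in
theorem aux_imprim (p n : ℕ) (hp : p.Prime) [NeZero (p ^ (n + 2))] [NeZero (p ^ n)]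
    (k : ZMod (p ^ (n + 2))) (ih : ∀ k', p ^ n ∣ auxT (p ^ n) k') :
    p ^ (n + 2) ∣ ∑ x : ZMod (p ^ (n + 2)), if IsUnit x then 0 else
        ∑ y : ZMod (p ^ (n + 2)), if IsUnit y then 0 else
          ∑ z : ZMod (p ^ (n + 2)), if IsUnit z then 0 else
          if x ^ 2 + y ^ 2 + z ^ 2 = k then 1 else 0 := by
  simp only [aux_nonunit_sum p n hp]
  by_cases hk : ∃ c : ℤ, k = (p : ZMod (p ^ (n + 2))) ^ 2 * c
  · obtain ⟨c, rfl⟩ := hk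
    have key : ∀ i j l : ℕ, ((p : ZMod (p ^ (n + 2))) * i) ^ 2 + (p * j) ^ 2 + (p * l) ^ 2
        = p ^ 2 * c ↔ (i : ZMod (p ^ n)) ^ 2 + j ^ 2 + l ^ 2 = c := by
      intro i j l
      have a1 : ((p : ZMod (p ^ (n + 2))) * i) ^ 2 + (p * j) ^ 2 + (p * l) ^ 2
        = p ^ 2 * c ↔ (((p : ℤ) ^ 2 * (i ^ 2 + j ^ 2 + l ^ 2 - c) : ℤ) : ZMod (p ^ (n + 2))) = 0 := by
        push_cast
        constructor <;> intro h <;> linear_combination h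
      have a2 : (i : ZMod (p ^ n)) ^ 2 + j ^ 2 + l ^ 2 = c ↔
          (((i ^ 2 + j ^ 2 + l ^ 2 - c) : ℤ) : ZMod (p ^ n)) = 0 := by
        push_cast
        constructor <;> intro h <;> linear_combination h
      rw [a1, a2, ZMod.intCast_zmod_eq_zero_iff_dvd, ZMod.intCast_zmod_eq_zero_iff_dvd]
      have : ((p ^ (n + 2) : ℕ) : ℤ) = (p : ℤ) ^ 2 * ((p ^ n : ℕ) : ℤ) := by
        push_cast; ring
      rw [this]
      exact mul_dvd_mul_iff_left (by have := hp.pos; positivity)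
    simp only [key]
    have per : ∀ g : ZMod (p ^ n) → ℕ, ∑ i ∈ Finset.range (p ^ n * p), g (i : ZMod (p ^ n))
        = p * ∑ x, g x := by
      intro g
      rw [aux_sum_range]
      exact aux_per (p ^ n) (fun i => g (i : ZMod (p ^ n))) (fun i => by
        have : ((p ^ n : ℕ) : ZMod (p ^ n)) = 0 := ZMod.natCast_self _
        simp only [Nat.cast_add, this, add_zero]) p
    have e : (∑ i ∈ Finset.range (p ^ n * p), ∑ j ∈ Finset.range (p ^ n * p),
        ∑ l ∈ Finset.range (p ^ n * p),
          if (i : ZMod (p ^ n)) ^ 2 + (j : ZMod (p ^ n)) ^ 2 + (l : ZMod (p ^ n)) ^ 2 = c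
          then 1 else 0) = p ^ 3 * auxT (p ^ n) c := by
      have s1 := fun x y : ZMod (p ^ n) =>
        per (fun z : ZMod (p ^ n) => if x ^ 2 + y ^ 2 + z ^ 2 = (c : ZMod (p ^ n)) then 1 else 0)
      simp only [s1]
      have s2 := fun x : ZMod (p ^ n) =>
        per (fun y : ZMod (p ^ n) => p * ∑ z : ZMod (p ^ n),
          if x ^ 2 + y ^ 2 + z ^ 2 = (c : ZMod (p ^ n)) then 1 else 0)
      simp only [s2]
      rw [per (fun x : ZMod (p ^ n) => p * ∑ y : ZMod (p ^ n), p * ∑ z : ZMod (p ^ n),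
        if x ^ 2 + y ^ 2 + z ^ 2 = (c : ZMod (p ^ n)) then 1 else 0)]
      unfold auxT
      simp only [← Finset.mul_sum]
      ring
    refine Dvd.dvd.trans ?_ (dvd_of_eq e.symm)
    obtain ⟨t, ht⟩ := ih c
    rw [ht]
    exact ⟨p * t, by ring⟩
  · refine Finset.dvd_sum fun i _ => Finset.dvd_sum fun j _ => Finset.dvd_sum fun l _ => ?_
    rw [if_neg]
    · exact dvd_zero _
    intro h
    apply hk
    refine ⟨(i ^ 2 + j ^ 2 + l ^ 2 : ℤ), ?_⟩
    rw [← h]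
    push_cast
    ring

theorem aux_step (p n P l : ℕ) (hp : p.Prime) [NeZero (p ^ (n + 2))] [NeZero (p ^ n)]
    (hN : P * l = p ^ (n + 2)) (hl : p ^ (n + 2) ∣ l * l) (hpP : p ∣ P)
    (hP : ∀ y : ZMod (p ^ (n + 2)), ∃ s : ZMod (p ^ (n + 2)), (y + P) ^ 2 - y ^ 2 = 4 * p * s)
    (ih : ∀ k', p ^ n ∣ auxT (p ^ n) k') (k : ZMod (p ^ (n + 2))) :
    p ^ (n + 2) ∣ auxT (p ^ (n + 2)) k := by
  classical
  have hq : IsNilpotent (p : ZMod (p ^ (n + 2))) :=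
    ⟨n + 2, by rw [← Nat.cast_pow]; exact ZMod.natCast_self _⟩
  have hPn : IsNilpotent (P : ZMod (p ^ (n + 2))) := by
    obtain ⟨c, rfl⟩ := hpP
    push_cast
    exact Commute.isNilpotent_mul_right (Commute.all _ _) hq
  have hun : ∀ y : ZMod (p ^ (n + 2)), IsUnit (y + P) ↔ IsUnit y := by
    intro y
    constructor
    · intro h
      have := (hPn.neg).isUnit_add_left_of_commute h (Commute.all _ _)
      simpa using this
    · intro h
      exact hPn.isUnit_add_left_of_commute h (Commute.all _ _)
  rw [aux_split]
  refine dvd_add (dvd_add (dvd_add ?_ ?_) ?_) ?_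
  · exact aux_prim _ P l p hN hl hq hP k (fun _ => 1) (fun _ => 1) (by simp) (by simp)
  · exact aux_prim _ P l p hN hl hq hP k (fun y => if IsUnit y then 0 else 1) (fun _ => 1)
      (by simp [hun]) (by simp)
  · exact aux_prim _ P l p hN hl hq hP k (fun y => if IsUnit y then 0 else 1)
      (fun y => if IsUnit y then 0 else 1) (by simp [hun]) (by simp [hun])
  · exact aux_imprim p n hp k ih

theorem auxT_card (N : ℕ) [NeZero N] (k : ZMod N) :
    auxT N k = (Finset.univ.filter fun x : Fin 3 → ZMod N => ∑ i, (x i) ^ 2 = k).card := by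
  rw [Finset.card_filter]
  unfold auxT
  rw [← (Fin.consEquiv (fun _ : Fin 3 => ZMod N)).sum_comp, Fintype.sum_prod_type]
  refine Finset.sum_congr rfl fun x _ => ?_
  rw [← (Fin.consEquiv (fun _ : Fin 2 => ZMod N)).sum_comp, Fintype.sum_prod_type]
  refine Finset.sum_congr rfl fun y _ => ?_
  rw [← (Equiv.funUnique (Fin 1) (ZMod N)).symm.sum_comp]
  refine Finset.sum_congr rfl fun z _ => ?_
  simp [Fin.sum_univ_succ, Fin.consEquiv, add_assoc]

theorem aux_prime (p : ℕ) (hp : p.Prime) [NeZero p] (k : ZMod p) : p ∣ auxT p k := by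
  have : Fact p.Prime := ⟨hp⟩
  rw [auxT_card]
  have := char_dvd_card_solutions (σ := Fin 3) (K := ZMod p) p
    (f := ∑ i, MvPolynomial.X i ^ 2 - MvPolynomial.C k) (by
      refine lt_of_le_of_lt (b := 2) ?_ (by simp)
      refine (MvPolynomial.totalDegree_sub_C_le _ _).trans ?_
      refine MvPolynomial.totalDegree_finsetSum_le fun i _ => ?_
      simp)
  rw [Fintype.card_subtype] at this
  simpa [sub_eq_zero] using this

theorem aux_dec4 : ∀ k : ZMod 4, 4 ∣ auxT 4 k := by unfold auxT; decide +kernel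

theorem aux_dec8 : ∀ k : ZMod 8, 8 ∣ auxT 8 k := by unfold auxT; decide +kernel

theorem aux_pp (p : ℕ) (hp : p.Prime) (n : ℕ) :
    ∀ [NeZero (p ^ n)] (k : ZMod (p ^ n)), p ^ n ∣ auxT (p ^ n) k := by
  induction n using Nat.strong_induction_on with
  | _ n ih =>
  intro inst k
  match n, ih, inst, k with
  | 0, _, _, _ => simp
  | 1, _, inst, k =>
    have : ∀ q (_ : q = p) [NeZero q] (k : ZMod q), q ∣ auxT q k := by
      rintro q rfl _ k
      exact aux_prime q hp k
    exact this _ (pow_one p) k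
  | n + 2, ih, inst, k =>
    have : NeZero (p ^ n) := ⟨(pow_pos hp.pos n).ne'⟩
    by_cases h2 : p = 2
    · subst h2
      match n, ih, inst, this, k with
      | 0, _, inst, _, k =>
        exact aux_dec4 k
      | 1, _, inst, _, k =>
        exact aux_dec8 k
      | n + 2, ih, inst, _, k =>
        refine aux_step 2 (n + 2) 4 (2 ^ (n + 2)) hp (by ring) ⟨2 ^ n, by ring⟩ (by norm_num)
          ?_ (fun k' => ih (n + 2) (by omega) k') k
        intro y
        exact ⟨y + 2, by push_cast; ring⟩
    · refine aux_step p n p (p ^ (n + 1)) hp (by ring) ⟨p ^ n, by ring⟩ dvd_rfl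
          ?_ (fun k' => ih n (by omega) k') k
      intro y
      have hu : IsUnit ((4 : ℕ) : ZMod (p ^ (n + 2))) := by
        rw [ZMod.isUnit_iff_coprime]
        apply Nat.Coprime.pow_right
        have : Nat.Coprime 2 p := (Nat.coprime_primes Nat.prime_two hp).2 (Ne.symm h2)
        exact Nat.Coprime.pow_left 2 this
      obtain ⟨u, hu⟩ := hu
      refine ⟨(2 * y + p) * (u⁻¹ : (ZMod (p ^ (n + 2)))ˣ), ?_⟩
      have h1 : (u : ZMod (p ^ (n + 2))) * (u⁻¹ : (ZMod (p ^ (n + 2)))ˣ) = 1 := by simp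
      rw [hu] at h1
      push_cast at h1
      linear_combination (-p * (2 * y + p)) * h1

theorem aux_crt (a b : ℕ) [NeZero a] [NeZero b] [NeZero (a * b)] (hab : a.Coprime b)
    (k : ZMod (a * b)) : ∃ k1 k2, auxT (a * b) k = auxT a k1 * auxT b k2 := by
  let e := ZMod.chineseRemainder hab
  refine ⟨(e k).1, (e k).2, ?_⟩
  unfold auxT
  have conv : ∀ f : ZMod (a * b) → ℕ, ∑ x, f x = ∑ x1, ∑ x2, f (e.symm (x1, x2)) := by
    intro f
    rw [← e.symm.toEquiv.sum_comp, Fintype.sum_prod_type]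
    rfl
  have key : ∀ x1 x2 y1 y2 z1 z2, ((e.symm (x1, x2)) ^ 2 + (e.symm (y1, y2)) ^ 2
      + (e.symm (z1, z2)) ^ 2 = k) ↔ (x1 ^ 2 + y1 ^ 2 + z1 ^ 2 = (e k).1 ∧
        x2 ^ 2 + y2 ^ 2 + z2 ^ 2 = (e k).2) := by
    intro x1 x2 y1 y2 z1 z2
    rw [← e.injective.eq_iff]
    simp [Prod.ext_iff]
  have split : ∀ (p q : Prop) [Decidable p] [Decidable q],
      (if p ∧ q then 1 else 0 : ℕ) = (if p then 1 else 0) * (if q then 1 else 0) := by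
    intro p q _ _
    by_cases p <;> by_cases q <;> simp [*]
  simp only [conv, key, split]
  simp only [← Finset.mul_sum, ← Finset.sum_mul]

theorem aux_three (N : ℕ) : ∀ [NeZero N] (k : ZMod N), N ∣ auxT N k := by
  induction N using Nat.recOnPosPrimePosCoprime with
  | prime_pow p n hp hn => exact aux_pp p hp n
  | zero => intro h; exact absurd rfl h.out
  | one => intro _ k; exact one_dvd _
  | coprime a b ha hb hab iha ihb =>
    intro _ k
    have : NeZero a := ⟨by omega⟩
    have : NeZero b := ⟨by omega⟩
    obtain ⟨k1, k2, h⟩ := aux_crt a b hab k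
    rw [h]
    exact mul_dvd_mul (iha k1) (ihb k2)

theorem stmt_14 (N : ℕ) [NeZero N] (d : ℕ) (hd : 3 ≤ d) (k : ZMod N) :
    N ∣ (Finset.univ.filter fun x : Fin d → ZMod N => ∑ i, (x i) ^ 2 = k).card := by
  induction d, hd using Nat.le_induction generalizing k with
  | base => rw [← auxT_card]; exact aux_three N k
  | succ d hd ih =>
    rw [Finset.card_filter, ← (Fin.consEquiv (fun _ : Fin (d + 1) => ZMod N)).sum_comp,
      Fintype.sum_prod_type]
    refine Finset.dvd_sum fun x _ => ?_
    have := ih (k - x ^ 2)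
    rw [Finset.card_filter] at this
    refine this.trans (dvd_of_eq (Finset.sum_congr rfl fun y _ => ?_))
    refine if_congr ?_ rfl rfl
    simp only [Fin.consEquiv, Equiv.coe_fn_mk, Fin.sum_univ_succ, Fin.cons_zero, Fin.cons_succ]
    constructor <;> intro h <;> linear_combination h
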